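/- The real polynomial p₆(u) = 32 − 144u − 80u² + 1512u³ − 4545u⁴ + 3168u⁵ − 624u⁶ + 216u⁹ − 96u^{10} has no real zero in the open interval (2, 9/4); and the real polynomial p₈(u) = 32·2^{1/6}3^{1/3} − 49·2^{1/3}3^{2/3}·u − 16√2·u² + 78·2^{2/3}3^{1/3}·u³ − 58u⁵ + 8·2^{1/6}3^{1/3}·u⁶ − 8√2·u⁸ has exactly one real zero in (0, ∞) and exactly one real zero in (−∞, 0), both simple. -/

import Mathlib

/-- The polynomial `p₈(u) = 32·2^{1/6}3^{1/3} - 49·2^{1/3}3^{2/3} u - 16√2 u²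
+ 78·2^{2/3}3^{1/3} u³ - 58u⁵ + 8·2^{1/6}3^{1/3} u⁶ - 8√2 u⁸`. -/
noncomputable def chazyp8 (u : ℝ) : ℝ :=
  32 * (2 : ℝ) ^ ((1 : ℝ) / 6) * (3 : ℝ) ^ ((1 : ℝ) / 3)
    - 49 * (2 : ℝ) ^ ((1 : ℝ) / 3) * (3 : ℝ) ^ ((2 : ℝ) / 3) * u
    - 16 * Real.sqrt 2 * u ^ 2
    + 78 * (2 : ℝ) ^ ((2 : ℝ) / 3) * (3 : ℝ) ^ ((1 : ℝ) / 3) * u ^ 3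
    - 58 * u ^ 5
    + 8 * (2 : ℝ) ^ ((1 : ℝ) / 6) * (3 : ℝ) ^ ((1 : ℝ) / 3) * u ^ 6
    - 8 * Real.sqrt 2 * u ^ 8

/-- The polynomial with integer coefficients proportional to `chazyp8` after the substitution
`u ↦ 2^{1/6} 3^{1/3} u`. -/
noncomputable def chazyp8Rescaled (u : ℝ) : ℝ :=
  864 - 1323 * u - 144 * u ^ 2 + 702 * u ^ 3 - 87 * u ^ 5 + 12 * u ^ 6 - 4 * u ^ 8

theorem chazyp8_eq_rescaled : ∃ s : ℝ, 0 < s ∧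
    ∀ u, chazyp8 u = s / 27 * chazyp8Rescaled (s * u) := by
  set a : ℝ := (2 : ℝ) ^ ((1 : ℝ) / 6) with ha
  set b : ℝ := (3 : ℝ) ^ ((1 : ℝ) / 3) with hb
  have ha0 : 0 < a := by positivity
  have hb0 : 0 < b := by positivity
  have ha2 : (2 : ℝ) ^ ((1 : ℝ) / 3) = a ^ 2 := by
    rw [ha, ← Real.rpow_mul_natCast (by norm_num)]; norm_num
  have ha4 : (2 : ℝ) ^ ((2 : ℝ) / 3) = a ^ 4 := by
    rw [ha, ← Real.rpow_mul_natCast (by norm_num)]; norm_num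
  have ha3 : Real.sqrt 2 = a ^ 3 := by
    rw [Real.sqrt_eq_rpow, ha, ← Real.rpow_mul_natCast (by norm_num)]; norm_num
  have ha6 : a ^ 6 = 2 := by
    rw [ha, ← Real.rpow_mul_natCast (by norm_num)]; norm_num
  have hb2 : (3 : ℝ) ^ ((2 : ℝ) / 3) = b ^ 2 := by
    rw [hb, ← Real.rpow_mul_natCast (by norm_num)]; norm_num
  have hb3 : b ^ 3 = 3 := by
    rw [hb, ← Real.rpow_mul_natCast (by norm_num)]; norm_num
  refine ⟨a * b, by positivity, fun u => ?_⟩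
  unfold chazyp8 chazyp8Rescaled
  rw [← ha, ← hb, ha2, ha3, ha4, hb2]
  have hb6 : b ^ 6 = 9 := by rw [show b ^ 6 = (b ^ 3) ^ 2 by ring, hb3]; norm_num
  have hb9 : b ^ 9 = 27 := by rw [show b ^ 9 = (b ^ 3) ^ 3 by ring, hb3]; norm_num
  have e3 : (a * b) ^ 3 = 3 * a ^ 3 := by rw [mul_pow, hb3]; ring
  have e4 : (a * b) ^ 4 = 3 * (a ^ 4 * b) := by
    rw [show (a * b) ^ 4 = a ^ 4 * b * b ^ 3 by ring, hb3]; ring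
  have e6 : (a * b) ^ 6 = 18 := by rw [mul_pow, ha6, hb6]; norm_num
  have e9 : (a * b) ^ 9 = 54 * a ^ 3 := by
    rw [show (a * b) ^ 9 = a ^ 6 * a ^ 3 * b ^ 9 by ring, ha6, hb9]; ring
  linear_combination (16 / 3 * u ^ 2) * e3 - 26 * u ^ 3 * e4
    + (29 / 9 * u ^ 5 - 4 / 9 * (a * b) * u ^ 6) * e6 + 4 / 27 * u ^ 8 * e9

theorem hasDerivAt_chazyp8Rescaled (u : ℝ) : HasDerivAt chazyp8Rescaled
    (-1323 - 288 * u + 2106 * u ^ 2 - 435 * u ^ 4 + 72 * u ^ 5 - 32 * u ^ 7) u := by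
  have h := (((((((hasDerivAt_const u (864 : ℝ)).sub ((hasDerivAt_id u).const_mul 1323)).sub
    ((hasDerivAt_pow 2 u).const_mul 144)).add ((hasDerivAt_pow 3 u).const_mul 702)).sub
    ((hasDerivAt_pow 5 u).const_mul 87)).add ((hasDerivAt_pow 6 u).const_mul 12)).sub
    ((hasDerivAt_pow 8 u).const_mul 4))
  refine h.congr_deriv ?_
  norm_num; ring

theorem continuous_chazyp8Rescaled : Continuous chazyp8Rescaled := by
  unfold chazyp8Rescaled; fun_prop

theorem deriv_chazyp8Rescaled_neg {u : ℝ} (hu : 2 ≤ u) : deriv chazyp8Rescaled u < 0 := by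
  obtain ⟨s, hs, rfl⟩ : ∃ s : ℝ, 0 ≤ s ∧ u = 2 + s := ⟨u - 2, by linarith, by ring⟩
  rw [(hasDerivAt_chazyp8Rescaled _).deriv, ← neg_pos]
  have : 0 < 2227 + 14360 * s + 24078 * s ^ 2 + 18520 * s ^ 3 + 8675 * s ^ 4 + 2616 * s ^ 5
      + 448 * s ^ 6 + 32 * s ^ 7 := by positivity
  linarith

theorem deriv_chazyp8Rescaled_pos {u : ℝ} (hu : u ≤ -1) : 0 < deriv chazyp8Rescaled u := by
  obtain ⟨s, hs, rfl⟩ : ∃ s : ℝ, 0 ≤ s ∧ u = -1 - s := ⟨-1 - u, by linarith, by ring⟩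
  rw [(hasDerivAt_chazyp8Rescaled _).deriv]
  have : 0 < 492 + 1748 * s + 13 * s ^ 4 + 224 * s ^ 6 + 32 * s ^ 7 + 600 * s * (s ^ 2 - 1) ^ 2
      + 276 * s * (s - 1) ^ 2 + 208 * s ^ 2 * (s - 1) ^ 2 + 104 * (s ^ 2 - 1) ^ 2 := by positivity
  linarith

theorem chazyp8Rescaled_pos_of_nonneg {u : ℝ} (h0 : 0 ≤ u) (h2 : u < 2) :
    0 < chazyp8Rescaled u := by
  rcases lt_or_ge u 1 with h | h
  · have h' : 0 < 1 - u := by linarith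
    have : chazyp8Rescaled u =
      864 * (1 - u) ^ 8 + 5589 * u * (1 - u) ^ 7 +
      14787 * u ^ 2 * (1 - u) ^ 6 + 20439 * u ^ 3 * (1 - u) ^ 5 +
      15525 * u ^ 4 * (1 - u) ^ 4 + 6132 * u ^ 5 * (1 - u) ^ 3 +
      1020 * u ^ 6 * (1 - u) ^ 2 + 60 * u ^ 7 * (1 - u) +
      20 * u ^ 8 := by
      unfold chazyp8Rescaled; ring
    rw [this]; positivity
  rcases lt_or_ge u (3 / 2) with h3 | h3
  · have h' : 0 < 3 / 2 - u := by linarith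
    have h'' : 0 ≤ u - 1 := by linarith
    have : chazyp8Rescaled u =
      5120 * (3 / 2 - u) ^ 8 + 53760 * (u - 1) * (3 / 2 - u) ^ 7 +
      307200 * (u - 1) ^ 2 * (3 / 2 - u) ^ 6 + 996096 * (u - 1) ^ 3 * (3 / 2 - u) ^ 5 +
      1887120 * (u - 1) ^ 4 * (3 / 2 - u) ^ 4 + 2134728 * (u - 1) ^ 5 * (3 / 2 - u) ^ 3 +
      1419624 * (u - 1) ^ 6 * (3 / 2 - u) ^ 2 + 510840 * (u - 1) ^ 7 * (3 / 2 - u) +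
      76356 * (u - 1) ^ 8 := by
      unfold chazyp8Rescaled; ring
    rw [this]; positivity
  · have h' : 0 < 2 - u := by linarith
    have h'' : 0 ≤ u - 3 / 2 := by linarith
    have : chazyp8Rescaled u =
      76356 * (2 - u) ^ 8 + 710856 * (u - 3 / 2) * (2 - u) ^ 7 +
      2819736 * (u - 3 / 2) ^ 2 * (2 - u) ^ 6 + 6197688 * (u - 3 / 2) ^ 3 * (2 - u) ^ 5 +
      8200800 * (u - 3 / 2) ^ 4 * (2 - u) ^ 4 + 6611136 * (u - 3 / 2) ^ 5 * (2 - u) ^ 3 +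
      3098496 * (u - 3 / 2) ^ 6 * (2 - u) ^ 2 + 731520 * (u - 3 / 2) ^ 7 * (2 - u) +
      55808 * (u - 3 / 2) ^ 8 := by
      unfold chazyp8Rescaled; ring
    rw [this]; positivity

theorem chazyp8Rescaled_pos_of_nonpos {u : ℝ} (h1 : -1 < u) (h0 : u ≤ 0) :
    0 < chazyp8Rescaled u := by
  have h' : 0 < u + 1 := by linarith
  have h'' : 0 ≤ -u := by linarith
  have : chazyp8Rescaled u =
    1436 * (-u) ^ 8 + 12084 * (u + 1) * (-u) ^ 7 +
    43068 * (u + 1) ^ 2 * (-u) ^ 6 + 84876 * (u + 1) ^ 3 * (-u) ^ 5 +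
    101115 * (u + 1) ^ 4 * (-u) ^ 4 + 74601 * (u + 1) ^ 5 * (-u) ^ 3 +
    33309 * (u + 1) ^ 6 * (-u) ^ 2 + 8235 * (u + 1) ^ 7 * (-u) +
    864 * (u + 1) ^ 8 := by
    unfold chazyp8Rescaled; ring
  rw [this]; positivity

theorem existsUnique_pos_root_chazyp8Rescaled : ∃ t : ℝ, 0 < t ∧ chazyp8Rescaled t = 0 ∧
    deriv chazyp8Rescaled t ≠ 0 ∧ ∀ v : ℝ, 0 < v → chazyp8Rescaled v = 0 → v = t := by
  have hc := continuous_chazyp8Rescaled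
  have hanti : StrictAntiOn chazyp8Rescaled (Set.Ici 2) :=
    strictAntiOn_of_deriv_neg (convex_Ici 2) hc.continuousOn fun x hx => by
      rw [interior_Ici] at hx
      exact deriv_chazyp8Rescaled_neg (le_of_lt hx)
  obtain ⟨t, ht, ht0⟩ : (0 : ℝ) ∈ chazyp8Rescaled '' Set.Icc 2 3 :=
    intermediate_value_Icc' (by norm_num) hc.continuousOn
      ⟨by norm_num [chazyp8Rescaled], by norm_num [chazyp8Rescaled]⟩
  refine ⟨t, by linarith [ht.1], ht0, (deriv_chazyp8Rescaled_neg ht.1).ne, fun v hv hv0 => ?_⟩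
  have hv2 : 2 ≤ v := by
    by_contra! h
    exact (chazyp8Rescaled_pos_of_nonneg hv.le h).ne' hv0
  exact hanti.injOn hv2 ht.1 (hv0.trans ht0.symm)

theorem existsUnique_neg_root_chazyp8Rescaled : ∃ t : ℝ, t < 0 ∧ chazyp8Rescaled t = 0 ∧
    deriv chazyp8Rescaled t ≠ 0 ∧ ∀ v : ℝ, v < 0 → chazyp8Rescaled v = 0 → v = t := by
  have hc := continuous_chazyp8Rescaled
  have hmono : StrictMonoOn chazyp8Rescaled (Set.Iic (-1)) :=
    strictMonoOn_of_deriv_pos (convex_Iic (-1)) hc.continuousOn fun x hx => by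
      rw [interior_Iic] at hx
      exact deriv_chazyp8Rescaled_pos (le_of_lt hx)
  obtain ⟨t, ht, ht0⟩ : (0 : ℝ) ∈ chazyp8Rescaled '' Set.Icc (-2) (-1) :=
    intermediate_value_Icc (by norm_num) hc.continuousOn
      ⟨by norm_num [chazyp8Rescaled], by norm_num [chazyp8Rescaled]⟩
  refine ⟨t, by linarith [ht.2], ht0, (deriv_chazyp8Rescaled_pos ht.2).ne', fun v hv hv0 => ?_⟩
  have hv1 : v ≤ -1 := by
    by_contra! h
    exact (chazyp8Rescaled_pos_of_nonpos h hv.le).ne' hv0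
  exact hmono.injOn hv1 ht.2 (hv0.trans ht0.symm)

theorem chazyp6_pos {u : ℝ} (h1 : 2 < u) (h2 : u < 9 / 4) :
    0 < 32 - 144 * u - 80 * u ^ 2 + 1512 * u ^ 3 - 4545 * u ^ 4 + 3168 * u ^ 5
        - 624 * u ^ 6 + 216 * u ^ 9 - 96 * u ^ 10 := by
  have h' : 0 < u - 2 := by linarith
  have h'' : 0 < 9 / 4 - u := by linarith
  have : 0 <
      13136560128 * (9 / 4 - u) ^ 10 + 134515523584 * (u - 2) * (9 / 4 - u) ^ 9 +
      612482154496 * (u - 2) ^ 2 * (9 / 4 - u) ^ 8 + 1628421226496 * (u - 2) ^ 3 * (9 / 4 - u) ^ 7 +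
      2788314836992 * (u - 2) ^ 4 * (9 / 4 - u) ^ 6 + 3193149857792 * (u - 2) ^ 5 * (9 / 4 - u) ^ 5 +
      2452251615232 * (u - 2) ^ 6 * (9 / 4 - u) ^ 4 + 1225141673984 * (u - 2) ^ 7 * (9 / 4 - u) ^ 3 +
      367450213120 * (u - 2) ^ 8 * (9 / 4 - u) ^ 2 + 54256130912 * (u - 2) ^ 9 * (9 / 4 - u) +
      1849032704 * (u - 2) ^ 10 := by
    positivity
  linarith

/-- Sturm facts for `q = 2`: `p₆` has no real zero in `(2, 9/4)`, and `p₈` has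
exactly one real zero in `(0, ∞)` and exactly one in `(-∞, 0)`, both simple. -/
theorem chazy_q2_sturm_p6_p8 :
    (∀ u ∈ Set.Ioo (2 : ℝ) (9 / 4),
      32 - 144 * u - 80 * u ^ 2 + 1512 * u ^ 3 - 4545 * u ^ 4 + 3168 * u ^ 5
        - 624 * u ^ 6 + 216 * u ^ 9 - 96 * u ^ 10 ≠ 0) ∧
    (∃ u : ℝ, 0 < u ∧ chazyp8 u = 0 ∧ deriv chazyp8 u ≠ 0 ∧
      ∀ v : ℝ, 0 < v → chazyp8 v = 0 → v = u) ∧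
    (∃ u : ℝ, u < 0 ∧ chazyp8 u = 0 ∧ deriv chazyp8 u ≠ 0 ∧
      ∀ v : ℝ, v < 0 → chazyp8 v = 0 → v = u) := by
  obtain ⟨s, hs, hp⟩ := chazyp8_eq_rescaled
  have hs0 : s ≠ 0 := hs.ne'
  have hzero (u : ℝ) : chazyp8 u = 0 ↔ chazyp8Rescaled (s * u) = 0 := by
    rw [hp]; simp [hs0]
  have hderiv (u : ℝ) : deriv chazyp8 u ≠ 0 ↔ deriv chazyp8Rescaled (s * u) ≠ 0 := by
    rw [funext hp, deriv_const_mul_field, deriv_comp_mul_left]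
    simp [hs0]
  have hdiv (t : ℝ) : s * (t / s) = t := by field_simp
  refine ⟨fun u hu => (chazyp6_pos hu.1 hu.2).ne', ?_, ?_⟩
  · obtain ⟨t, ht, h0, hd, huniq⟩ := existsUnique_pos_root_chazyp8Rescaled
    refine ⟨t / s, by positivity, by rwa [hzero, hdiv], by rwa [hderiv, hdiv], fun v hv hv0 => ?_⟩
    rw [← huniq (s * v) (by positivity) ((hzero v).1 hv0)]
    field_simp
  · obtain ⟨t, ht, h0, hd, huniq⟩ := existsUnique_neg_root_chazyp8Rescaled
    refine ⟨t / s, div_neg_of_neg_of_pos ht hs, by rwa [hzero, hdiv], by rwa [hderiv, hdiv],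
      fun v hv hv0 => ?_⟩
    rw [← huniq (s * v) (mul_neg_of_pos_of_neg hs hv) ((hzero v).1 hv0)]
    field_simp
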